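/- Let (η, w) be a global smooth solution of the 1D isentropic compressible Navier–Stokes system on [0,∞) × T with initial data satisfying 0 < ς̲₀ ≤ η₀(x) ≤ ς̄₀ for all x, ∫_T η₀ dx = 1 and ∫_T η₀ w₀ dx = 0, and set E₀₀ := ∫_T ( (1/2) η₀ w₀² + P(η₀) ) dx. Then there exists a constant η̄ > 0, depending only on (a, γ, ν, ς̄₀, E₀₀), such that η(t,x) ≤ η̄ for all t ≥ 0 and all x ∈ T. -/

import Mathlib

open MeasureTheory

/-- The pressure potential `P` associated with the pressure law `p(s) = a s^γ`:
`P(s) = a s^γ/(γ-1)` if `γ > 1` and `P(s) = a (s log s + 1)` if `γ = 1`. -/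
noncomputable def Ppot (a γ : ℝ) (s : ℝ) : ℝ :=
  if γ = 1 then a * (s * Real.log s + 1) else a * s ^ γ / (γ - 1)

open Set Function Topology

/-- Differentiation under the integral sign for an integrand whose parameter derivative is
continuous on a neighbourhood of the parameter times the (compact) domain of integration. -/
lemma hasDerivAt_intervalIntegral_of_continuousOn {f f' : ℝ → ℝ → ℝ} {t ε α β : ℝ} (hε : 0 < ε)
    (hf : ∀ s ∈ Metric.closedBall t ε, ContinuousOn (f s) (uIcc α β))
    (hd : ∀ s ∈ Metric.closedBall t ε, ∀ y ∈ uIcc α β, HasDerivAt (fun r => f r y) (f' s y) s)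
    (hc : ContinuousOn (uncurry f') (Metric.closedBall t ε ×ˢ uIcc α β)) :
    HasDerivAt (fun s => ∫ y in α..β, f s y) (∫ y in α..β, f' t y) t := by
  obtain ⟨C, hC⟩ :=
    ((isCompact_closedBall t ε).prod isCompact_uIcc).exists_bound_of_continuousOn hc
  have hball : Metric.closedBall t ε ∈ 𝓝 t := Metric.closedBall_mem_nhds t hε
  have ht : t ∈ Metric.closedBall t ε := Metric.mem_closedBall_self hε.le
  have hc' : ContinuousOn (f' t) (uIcc α β) :=
    hc.comp (f := fun y => (t, y)) (by fun_prop) fun y hy => ⟨ht, hy⟩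
  refine (intervalIntegral.hasDerivAt_integral_of_dominated_loc_of_deriv_le
    (bound := fun _ => C) hball ?_ (hf t ht).intervalIntegrable ?_ ?_ ?_ ?_).2
  · filter_upwards [hball] with s hs
    exact ((hf s hs).mono uIoc_subset_uIcc).aestronglyMeasurable measurableSet_uIoc
  · exact (hc'.mono uIoc_subset_uIcc).aestronglyMeasurable measurableSet_uIoc
  · exact .of_forall fun y hy s hs => hC (s, y) ⟨hs, uIoc_subset_uIcc hy⟩
  · exact intervalIntegrable_const
  · exact .of_forall fun y hy s hs => hd s hs y (uIoc_subset_uIcc hy)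

/-- Differentiation under the integral sign for globally `C¹` integrands. -/
lemma hasDerivAt_intervalIntegral_of_continuous {f f' : ℝ → ℝ → ℝ}
    (hf : Continuous (uncurry f)) (hd : ∀ s y, HasDerivAt (fun r => f r y) (f' s y) s)
    (hc : Continuous (uncurry f')) (t α β : ℝ) :
    HasDerivAt (fun s => ∫ y in α..β, f s y) (∫ y in α..β, f' t y) t :=
  hasDerivAt_intervalIntegral_of_continuousOn one_pos
    (fun s _ => (hf.comp (Continuous.prodMk_right s)).continuousOn)
    (fun s _ y _ => hd s y) hc.continuousOn

lemma ContDiff.hasDerivAt_fst {f : ℝ → ℝ → ℝ} (hf : ContDiff ℝ (⊤ : ℕ∞) (uncurry f)) (t x : ℝ) :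
    HasDerivAt (fun s => f s x) (fderiv ℝ (uncurry f) (t, x) (1, 0)) t :=
  ((hf.differentiable (by simp)) (t, x)).hasFDerivAt.comp_hasDerivAt (f := fun s => (s, x)) t
    ((hasDerivAt_id t).prodMk (hasDerivAt_const t x))

lemma ContDiff.hasDerivAt_snd {f : ℝ → ℝ → ℝ} (hf : ContDiff ℝ (⊤ : ℕ∞) (uncurry f)) (t x : ℝ) :
    HasDerivAt (f t) (fderiv ℝ (uncurry f) (t, x) (0, 1)) x :=
  ((hf.differentiable (by simp)) (t, x)).hasFDerivAt.comp_hasDerivAt (f := fun y => (t, y)) x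
    ((hasDerivAt_const x t).prodMk (hasDerivAt_id x))

lemma ContDiff.uncurry_fderiv_apply {f : ℝ → ℝ → ℝ} (hf : ContDiff ℝ (⊤ : ℕ∞) (uncurry f))
    (v : ℝ × ℝ) :
    ContDiff ℝ (⊤ : ℕ∞) (uncurry fun t x => fderiv ℝ (uncurry f) (t, x) v) :=
  (hf.fderiv_right (m := (⊤ : ℕ∞)) (by simp)).clm_apply contDiff_const

/-- The derivative of `Ppot a γ` on `(0, ∞)`. -/
noncomputable def PpotDeriv (a γ s : ℝ) : ℝ :=
  if γ = 1 then a * (Real.log s + 1) else a * γ * s ^ (γ - 1) / (γ - 1)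

lemma hasDerivAt_Ppot (a γ : ℝ) {s : ℝ} (hs : 0 < s) :
    HasDerivAt (Ppot a γ) (PpotDeriv a γ s) s := by
  unfold Ppot PpotDeriv
  split_ifs with h
  · have h1 := (((hasDerivAt_id s).mul (Real.hasDerivAt_log hs.ne')).add_const 1).const_mul a
    refine h1.congr_deriv ?_
    simp [hs.ne']
  · refine (((Real.hasDerivAt_rpow_const (p := γ) (Or.inl hs.ne')).const_mul a).div_const
      (γ - 1)).congr_deriv ?_
    ring

lemma hasDerivAt_PpotDeriv (a γ : ℝ) {s : ℝ} (hs : 0 < s) :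
    HasDerivAt (PpotDeriv a γ) (a * γ * s ^ (γ - 1) / s) s := by
  unfold PpotDeriv
  split_ifs with h
  · subst h
    refine (((Real.hasDerivAt_log hs.ne').add_const 1).const_mul a).congr_deriv ?_
    simp [div_eq_mul_inv]
  · refine (((Real.hasDerivAt_rpow_const (p := γ - 1) (Or.inl hs.ne')).const_mul (a * γ)).div_const
      (γ - 1)).congr_deriv ?_
    rw [Real.rpow_sub_one hs.ne' (γ - 1)]
    have := sub_ne_zero.mpr h
    field_simp

lemma Ppot_nonneg {a γ s : ℝ} (ha : 0 < a) (hγ : 1 ≤ γ) (hs : 0 < s) : 0 ≤ Ppot a γ s := by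
  unfold Ppot
  split_ifs with h
  · have h1 := Real.one_sub_inv_le_log_of_pos hs
    have h2 : s * (1 - s⁻¹) ≤ s * Real.log s := mul_le_mul_of_nonneg_left h1 hs.le
    rw [mul_sub, mul_inv_cancel₀ hs.ne'] at h2
    have : 0 ≤ s * Real.log s + 1 := by linarith
    positivity
  · have : 0 ≤ γ - 1 := by linarith
    positivity

lemma pressure_le_Ppot {a γ s : ℝ} (ha : 0 < a) (hγ : 1 ≤ γ) (hs : 0 < s) :
    a * s ^ γ ≤ γ * Ppot a γ s := by
  have h0 := Ppot_nonneg ha hγ hs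
  by_cases h : γ = 1
  · subst h
    have h1 := Real.one_sub_inv_le_log_of_pos hs
    have h2 : s * (1 - s⁻¹) ≤ s * Real.log s := mul_le_mul_of_nonneg_left h1 hs.le
    rw [mul_sub, mul_inv_cancel₀ hs.ne'] at h2
    simp only [Ppot, if_true, Real.rpow_one, one_mul]
    exact mul_le_mul_of_nonneg_left (by linarith) ha.le
  · have h1 : (γ - 1) * Ppot a γ s = a * s ^ γ := by
      have := sub_ne_zero.mpr h
      simp only [Ppot, if_neg h]
      field_simp
    linarith

/-- A smooth solution of the 1D isentropic compressible Navier–Stokes system on `[0, ∞) × 𝕋`,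
together with its partial derivatives, with unit mass and zero momentum initially. -/
structure IsNSFlow (a γ ν : ℝ) (η w ηt ηx wt wx wxx : ℝ → ℝ → ℝ) : Prop where
  cη : Continuous (uncurry η)
  cw : Continuous (uncurry w)
  cηt : Continuous (uncurry ηt)
  cηx : Continuous (uncurry ηx)
  cwt : Continuous (uncurry wt)
  cwx : Continuous (uncurry wx)
  cwxx : Continuous (uncurry wxx)
  hηt : ∀ t x, HasDerivAt (fun s => η s x) (ηt t x) t
  hηx : ∀ t x, HasDerivAt (η t) (ηx t x) x
  hwt : ∀ t x, HasDerivAt (fun s => w s x) (wt t x) t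
  hwx : ∀ t x, HasDerivAt (w t) (wx t x) x
  hwxx : ∀ t x, HasDerivAt (wx t) (wxx t x) x
  perη : ∀ t x, η t (x + 1) = η t x
  perw : ∀ t x, w t (x + 1) = w t x
  pos : ∀ t x, 0 ≤ t → 0 < η t x
  mass : ∀ t x, 0 ≤ t → ηt t x + (ηx t x * w t x + η t x * wx t x) = 0
  momentum : ∀ t x, 0 ≤ t → η t x * (wt t x + w t x * wx t x) - ν * wxx t x
    + a * γ * η t x ^ (γ - 1) * ηx t x = 0
  total_mass : ∫ x in (0:ℝ)..1, η 0 x = 1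
  total_momentum : ∫ x in (0:ℝ)..1, η 0 x * w 0 x = 0

namespace IsNSFlow

variable {a γ ν : ℝ} {η w ηt ηx wt wx wxx : ℝ → ℝ → ℝ}

lemma perwx (h : IsNSFlow a γ ν η w ηt ηx wt wx wxx) (t x : ℝ) : wx t (x + 1) = wx t x := by
  have h1 := (h.hwx t (x + 1)).comp_add_const x 1
  simp only [h.perw] at h1
  exact h1.unique (h.hwx t x)

/-- A quantity whose time derivative is a spatial divergence has constant integral. -/
lemma integral_eq_of_conservation {f f' Φ : ℝ → ℝ → ℝ} (hf : Continuous (uncurry f))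
    (hd : ∀ s y, HasDerivAt (fun r => f r y) (f' s y) s) (hc : Continuous (uncurry f'))
    (hΦ : ∀ s y, 0 ≤ s → HasDerivAt (Φ s) (f' s y) y) (per : ∀ s, 0 ≤ s → Φ s 1 = Φ s 0)
    {t : ℝ} (ht : 0 ≤ t) : ∫ y in (0:ℝ)..1, f t y = ∫ y in (0:ℝ)..1, f 0 y := by
  have key : ∀ s, 0 ≤ s → HasDerivAt (fun s => ∫ y in (0:ℝ)..1, f s y) 0 s := by
    intro s hs
    have h1 := hasDerivAt_intervalIntegral_of_continuous hf hd hc s 0 1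
    rwa [intervalIntegral.integral_eq_sub_of_hasDerivAt (fun y _ => hΦ s y hs)
      ((hc.comp (Continuous.prodMk_right s)).intervalIntegrable _ _), per s hs, sub_self] at h1
  exact constant_of_has_deriv_right_zero (a := 0) (b := t)
    (fun s hs => (key s hs.1).continuousAt.continuousWithinAt)
    (fun s hs => (key s hs.1).hasDerivWithinAt) t ⟨ht, le_rfl⟩

lemma integral_density (h : IsNSFlow a γ ν η w ηt ηx wt wx wxx) {t : ℝ} (ht : 0 ≤ t) :
    ∫ y in (0:ℝ)..1, η t y = 1 := by
  refine Eq.trans ?_ h.total_mass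
  refine integral_eq_of_conservation (Φ := fun s y => -(η s y * w s y)) h.cη h.hηt h.cηt
    (fun s y hs => ?_) (fun s _ => ?_) ht
  · refine ((h.hηx s y).mul (h.hwx s y)).neg.congr_deriv ?_
    linarith [h.mass s y hs]
  · have h1 := h.perη s 0
    have h2 := h.perw s 0
    rw [zero_add] at h1 h2
    simp only [h1, h2]

/-- The time derivative of the momentum density `η w`. -/
lemma hasDerivAt_momentum (h : IsNSFlow a γ ν η w ηt ηx wt wx wxx) (t x : ℝ) :
    HasDerivAt (fun s => η s x * w s x) (ηt t x * w t x + η t x * wt t x) t :=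
  (h.hηt t x).mul (h.hwt t x)

lemma continuous_momentum (h : IsNSFlow a γ ν η w ηt ηx wt wx wxx) :
    Continuous (uncurry fun t x => η t x * w t x) :=
  h.cη.mul h.cw

lemma continuous_momentum_deriv (h : IsNSFlow a γ ν η w ηt ηx wt wx wxx) :
    Continuous (uncurry fun t x => ηt t x * w t x + η t x * wt t x) :=
  (h.cηt.mul h.cw).add (h.cη.mul h.cwt)

/-- The momentum flux `η w² + p(η) - ν ∂ₓw`. -/
lemma hasDerivAt_flux (h : IsNSFlow a γ ν η w ηt ηx wt wx wxx) {t : ℝ} (ht : 0 ≤ t) (x : ℝ) :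
    HasDerivAt (fun y => η t y * w t y ^ 2 + a * η t y ^ γ - ν * wx t y)
      (-(ηt t x * w t x + η t x * wt t x)) x := by
  refine ((((h.hηx t x).mul ((h.hwx t x).pow 2)).add
    (((h.hηx t x).rpow_const (p := γ) (Or.inl (h.pos t x ht).ne')).const_mul a)).sub
    ((h.hwxx t x).const_mul ν)).congr_deriv ?_
  have h1 := h.mass t x ht
  have h2 := h.momentum t x ht
  push_cast
  simp only [pow_one, Pi.pow_apply]
  linear_combination h2 + w t x * h1

lemma flux_periodic (h : IsNSFlow a γ ν η w ηt ηx wt wx wxx) (t : ℝ) :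
    η t 1 * w t 1 ^ 2 + a * η t 1 ^ γ - ν * wx t 1
      = η t 0 * w t 0 ^ 2 + a * η t 0 ^ γ - ν * wx t 0 := by
  have h1 := h.perη t 0
  have h2 := h.perw t 0
  have h3 := h.perwx t 0
  rw [zero_add] at h1 h2 h3
  rw [h1, h2, h3]

lemma integral_momentum (h : IsNSFlow a γ ν η w ηt ηx wt wx wxx) {t : ℝ} (ht : 0 ≤ t) :
    ∫ y in (0:ℝ)..1, η t y * w t y = 0 := by
  refine Eq.trans ?_ h.total_momentum
  refine integral_eq_of_conservation
    (Φ := fun s y => -(η s y * w s y ^ 2 + a * η s y ^ γ - ν * wx s y))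
    h.continuous_momentum h.hasDerivAt_momentum h.continuous_momentum_deriv
    (fun s y hs => ?_) (fun s _ => ?_) ht
  · exact (h.hasDerivAt_flux hs y).fun_neg.congr_deriv (neg_neg _)
  · simp only [h.flux_periodic s]

lemma continuousOn_Ppot (a γ : ℝ) : ContinuousOn (Ppot a γ) (Ioi 0) :=
  fun _ hs => (hasDerivAt_Ppot a γ hs).continuousAt.continuousWithinAt

lemma continuousOn_PpotDeriv (a γ : ℝ) : ContinuousOn (PpotDeriv a γ) (Ioi 0) :=
  fun _ hs => (hasDerivAt_PpotDeriv a γ hs).continuousAt.continuousWithinAt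

/-- The energy density `η w² / 2 + P(η)`. -/
noncomputable def energyDensity (a γ : ℝ) (η w : ℝ → ℝ → ℝ) (t x : ℝ) : ℝ :=
  (1 / 2) * η t x * (w t x) ^ 2 + Ppot a γ (η t x)

lemma continuousOn_energyDensity (h : IsNSFlow a γ ν η w ηt ηx wt wx wxx) :
    ContinuousOn (uncurry (energyDensity a γ η w)) (Ici 0 ×ˢ univ) := by
  have h1 : ContinuousOn (fun p : ℝ × ℝ => Ppot a γ (uncurry η p)) (Ici 0 ×ˢ univ) :=
    (continuousOn_Ppot a γ).comp h.cη.continuousOn fun p hp => h.pos p.1 p.2 hp.1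
  exact ((continuous_const.mul h.cη).mul (h.cw.pow 2)).continuousOn.add h1

lemma continuous_energyDensity_slice (h : IsNSFlow a γ ν η w ηt ηx wt wx wxx) {t : ℝ}
    (ht : 0 ≤ t) : Continuous (energyDensity a γ η w t) :=
  h.continuousOn_energyDensity.comp_continuous (Continuous.prodMk_right t) fun _ => ⟨ht, trivial⟩

lemma hasDerivAt_energyFlux (h : IsNSFlow a γ ν η w ηt ηx wt wx wxx) {t : ℝ} (ht : 0 ≤ t)
    (x : ℝ) :
    HasDerivAt (fun y => ν * (w t y * wx t y) - (1 / 2) * (η t y * w t y ^ 3)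
        - PpotDeriv a γ (η t y) * (η t y * w t y))
      (((1 / 2) * ηt t x * w t x ^ 2 + η t x * w t x * wt t x + PpotDeriv a γ (η t x) * ηt t x)
        + ν * wx t x ^ 2) x := by
  have hpos := h.pos t x ht
  refine (((((h.hwx t x).mul (h.hwxx t x)).const_mul ν).sub
    (((h.hηx t x).mul ((h.hwx t x).pow 3)).const_mul (1 / 2))).sub
    (((hasDerivAt_PpotDeriv a γ hpos).comp x (h.hηx t x)).mul
      ((h.hηx t x).mul (h.hwx t x)))).congr_deriv ?_
  have h1 := h.mass t x ht
  have h2 := h.momentum t x ht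
  have h3 : a * γ * η t x ^ (γ - 1) / η t x * ηx t x * (η t x * w t x)
      = a * γ * η t x ^ (γ - 1) * ηx t x * w t x := by
    field_simp
  simp only [Function.comp_apply, Pi.mul_apply, Pi.pow_apply]
  push_cast
  rw [h3]
  linear_combination (-(w t x)) * h2 - (1 / 2 * w t x ^ 2 + PpotDeriv a γ (η t x)) * h1

/-- The energy is nonincreasing in time. -/
lemma integral_energyDensity_le (h : IsNSFlow a γ ν η w ηt ηx wt wx wxx) (hν : 0 < ν) {t : ℝ}
    (ht : 0 ≤ t) :
    ∫ y in (0:ℝ)..1, energyDensity a γ η w t y ≤ ∫ y in (0:ℝ)..1, energyDensity a γ η w 0 y := by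
  have hcont : ContinuousOn (fun s => ∫ y in (0:ℝ)..1, energyDensity a γ η w s y) (Ici 0) := by
    have h1 : Continuous (uncurry fun s y => energyDensity a γ η w (max s 0) y) :=
      h.continuousOn_energyDensity.comp_continuous (f := fun p : ℝ × ℝ => (max p.1 0, p.2))
        (by fun_prop) fun p => ⟨mem_Ici.mpr (le_max_right _ _), trivial⟩
    refine (intervalIntegral.continuous_parametric_intervalIntegral_of_continuous'
      (μ := MeasureTheory.volume) h1 0 1).continuousOn.congr fun s hs => ?_
    simp only [max_eq_left (mem_Ici.mp hs)]
  have hderiv : ∀ s, 0 < s → HasDerivAt (fun s => ∫ y in (0:ℝ)..1, energyDensity a γ η w s y)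
      (∫ y in (0:ℝ)..1, ((1 / 2) * ηt s y * w s y ^ 2 + η s y * w s y * wt s y
        + PpotDeriv a γ (η s y) * ηt s y)) s := by
    intro s hs
    have hball : ∀ r ∈ Metric.closedBall s (s / 2), 0 ≤ r := by
      intro r hr
      rw [Real.closedBall_eq_Icc] at hr
      linarith [hr.1]
    refine hasDerivAt_intervalIntegral_of_continuousOn (ε := s / 2) (by positivity)
      (fun r hr => (h.continuous_energyDensity_slice (hball r hr)).continuousOn)
      (f' := fun s y => (1 / 2) * ηt s y * w s y ^ 2 + η s y * w s y * wt s y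
        + PpotDeriv a γ (η s y) * ηt s y)
      (fun r hr y _ => ?_) ?_
    · refine ((((h.hηt r y).const_mul (1 / 2)).mul ((h.hwt r y).pow 2)).add
        ((hasDerivAt_Ppot a γ (h.pos r y (hball r hr))).comp r (h.hηt r y))).congr_deriv ?_
      simp only [Pi.pow_apply]
      push_cast
      ring
    · have h1 : ContinuousOn (fun p : ℝ × ℝ => PpotDeriv a γ (uncurry η p))
          (Metric.closedBall s (s / 2) ×ˢ uIcc 0 1) :=
        (continuousOn_PpotDeriv a γ).comp h.cη.continuousOn
          fun p hp => h.pos p.1 p.2 (hball _ hp.1)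
      exact ((((continuous_const.mul h.cηt).mul (h.cw.pow 2)).add
        ((h.cη.mul h.cw).mul h.cwt)).continuousOn).add (h1.mul h.cηt.continuousOn)
  have hnonpos : ∀ s, 0 < s → (∫ y in (0:ℝ)..1, ((1 / 2) * ηt s y * w s y ^ 2
      + η s y * w s y * wt s y + PpotDeriv a γ (η s y) * ηt s y)) ≤ 0 := by
    intro s hs
    have cs : ∀ {f : ℝ → ℝ → ℝ}, Continuous (uncurry f) → Continuous (f s) :=
      fun hf => hf.comp (Continuous.prodMk_right s)
    have cP : Continuous fun y => PpotDeriv a γ (η s y) :=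
      (continuousOn_PpotDeriv a γ).comp_continuous (cs h.cη) fun y => h.pos s y hs.le
    have c1 : Continuous fun y => (1 / 2) * ηt s y * w s y ^ 2
      + η s y * w s y * wt s y + PpotDeriv a γ (η s y) * ηt s y :=
      (((continuous_const.mul (cs h.cηt)).mul ((cs h.cw).pow 2)).add
        (((cs h.cη).mul (cs h.cw)).mul (cs h.cwt))).add (cP.mul (cs h.cηt))
    have c2 : Continuous fun y => ν * wx s y ^ 2 := continuous_const.mul ((cs h.cwx).pow 2)
    have h1 := intervalIntegral.integral_eq_sub_of_hasDerivAt (a := 0) (b := 1)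
      (fun y _ => h.hasDerivAt_energyFlux hs.le y) ((c1.add c2).intervalIntegrable _ _)
    have p1 := h.perη s 0
    have p2 := h.perw s 0
    have p3 := h.perwx s 0
    rw [zero_add] at p1 p2 p3
    rw [p1, p2, p3, sub_self, intervalIntegral.integral_add (c1.intervalIntegrable _ _)
      (c2.intervalIntegrable _ _)] at h1
    have h2 : 0 ≤ ∫ y in (0:ℝ)..1, ν * wx s y ^ 2 :=
      intervalIntegral.integral_nonneg zero_le_one fun y _ => by positivity
    linarith
  refine antitoneOn_of_hasDerivWithinAt_nonpos (convex_Ici 0) hcont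
    (fun s hs => (hderiv s ?_).hasDerivWithinAt) (fun s hs => hnonpos s ?_) self_mem_Ici ht ht
  all_goals simpa using hs

/-- The zero-mean primitive in space of the momentum density. -/
noncomputable def momentumPotential (η w : ℝ → ℝ → ℝ) (t x : ℝ) : ℝ :=
  (∫ y in (0:ℝ)..x, η t y * w t y) - ∫ y in (0:ℝ)..1, (1 - y) * (η t y * w t y)

lemma continuous_momentumPotential (h : IsNSFlow a γ ν η w ηt ηx wt wx wxx) :
    Continuous (uncurry (momentumPotential η w)) := by
  have h1 : Continuous fun p : ℝ × ℝ => ∫ y in (0:ℝ)..p.2, η p.1 y * w p.1 y :=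
    intervalIntegral.continuous_parametric_primitive_of_continuous h.continuous_momentum
  have h2 : Continuous fun s : ℝ => ∫ y in (0:ℝ)..1, (1 - y) * (η s y * w s y) :=
    intervalIntegral.continuous_parametric_intervalIntegral_of_continuous'
      ((continuous_const.sub continuous_snd).mul h.continuous_momentum) 0 1
  exact h1.sub (h2.comp continuous_fst)

lemma hasDerivAt_momentumPotential_snd (h : IsNSFlow a γ ν η w ηt ηx wt wx wxx) (t x : ℝ) :
    HasDerivAt (momentumPotential η w t) (η t x * w t x) x := by
  have hc : Continuous fun y => η t y * w t y :=
    h.continuous_momentum.comp (Continuous.prodMk_right t)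
  exact (intervalIntegral.integral_hasDerivAt_right (hc.intervalIntegrable _ _)
    (hc.stronglyMeasurableAtFilter _ _) hc.continuousAt).sub_const _

lemma momentumPotential_periodic (h : IsNSFlow a γ ν η w ηt ηx wt wx wxx) {t : ℝ} (ht : 0 ≤ t)
    (x : ℝ) : momentumPotential η w t (x + 1) = momentumPotential η w t x := by
  have hc : Continuous fun y => η t y * w t y :=
    h.continuous_momentum.comp (Continuous.prodMk_right t)
  have hp : Function.Periodic (fun y => η t y * w t y) 1 := fun y => by
    simp only [h.perη, h.perw]
  have h1 := hp.intervalIntegral_add_eq x 0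
  rw [zero_add, h.integral_momentum ht] at h1
  have h2 := intervalIntegral.integral_add_adjacent_intervals
    (μ := MeasureTheory.volume) (hc.intervalIntegrable 0 x) (hc.intervalIntegrable x (x + 1))
  simp only [momentumPotential]
  linarith

lemma continuous_pressure_add (h : IsNSFlow a γ ν η w ηt ηx wt wx wxx) {t : ℝ} (ht : 0 ≤ t) :
    Continuous fun y => η t y * w t y ^ 2 + a * η t y ^ γ := by
  have c1 : Continuous (η t) := h.cη.comp (Continuous.prodMk_right t)
  have c2 : Continuous (w t) := h.cw.comp (Continuous.prodMk_right t)
  exact (c1.mul (c2.pow 2)).add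
    (continuous_const.mul (c1.rpow_const fun y => Or.inl (h.pos t y ht).ne'))

lemma hasDerivAt_momentumPotential_fst (h : IsNSFlow a γ ν η w ηt ηx wt wx wxx) {t : ℝ}
    (ht : 0 ≤ t) (x : ℝ) :
    HasDerivAt (fun s => momentumPotential η w s x)
      (-(η t x * w t x ^ 2 + a * η t x ^ γ - ν * wx t x)
        + ∫ y in (0:ℝ)..1, (η t y * w t y ^ 2 + a * η t y ^ γ)) t := by
  set G : ℝ → ℝ := fun y => η t y * w t y ^ 2 + a * η t y ^ γ - ν * wx t y with hG
  set m' : ℝ → ℝ := fun y => ηt t y * w t y + η t y * wt t y with hm'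
  have cm' : Continuous m' := h.continuous_momentum_deriv.comp (Continuous.prodMk_right t)
  have cwx : Continuous (wx t) := h.cwx.comp (Continuous.prodMk_right t)
  have hGd : ∀ y, HasDerivAt G (-m' y) y := h.hasDerivAt_flux ht
  have cym' : Continuous fun y => (1 - y) * m' y := (continuous_const.sub continuous_id).mul cm'
  have cνwx : Continuous fun y => ν * wx t y := continuous_const.mul cwx
  have cG : Continuous G := continuous_iff_continuousAt.mpr fun y => (hGd y).continuousAt
  have d1 := hasDerivAt_intervalIntegral_of_continuous h.continuous_momentum
    h.hasDerivAt_momentum h.continuous_momentum_deriv t 0 x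
  have d2 := hasDerivAt_intervalIntegral_of_continuous
    (f := fun s y => (1 - y) * (η s y * w s y))
    (f' := fun s y => (1 - y) * (ηt s y * w s y + η s y * wt s y))
    ((continuous_const.sub continuous_snd).mul h.continuous_momentum)
    (fun s y => (h.hasDerivAt_momentum s y).const_mul (1 - y))
    ((continuous_const.sub continuous_snd).mul h.continuous_momentum_deriv) t 0 1
  refine (d1.sub d2).congr_deriv ?_
  have e1 : ∫ y in (0:ℝ)..x, m' y = G 0 - G x := by
    rw [intervalIntegral.integral_eq_sub_of_hasDerivAt (f := fun y => -G y)
      (fun y _ => by simpa using (hGd y).fun_neg) (cm'.intervalIntegrable _ _)]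
    ring
  have e2 : ∫ y in (0:ℝ)..1, ((1 - y) * m' y + G y) = G 0 := by
    rw [intervalIntegral.integral_eq_sub_of_hasDerivAt (f := fun y => -((1 - y) * G y))
      (f' := fun y => (1 - y) * m' y + G y)
      (fun y _ => ?_)
      ((cym'.add cG).intervalIntegrable _ _)]
    · ring
    · refine ((((hasDerivAt_id y).const_sub 1).mul (hGd y)).neg).congr_deriv ?_
      simp only [id_eq]
      ring
  have e3 : ∫ y in (0:ℝ)..1, ν * wx t y = 0 := by
    rw [intervalIntegral.integral_eq_sub_of_hasDerivAt (f := fun y => ν * w t y)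
      (fun y _ => (h.hwx t y).const_mul ν) (cνwx.intervalIntegrable _ _)]
    have p := h.perw t 0
    rw [zero_add] at p
    rw [p, sub_self]
  have e4 : ∫ y in (0:ℝ)..1, G y = ∫ y in (0:ℝ)..1, (η t y * w t y ^ 2 + a * η t y ^ γ) := by
    simp only [hG]
    rw [intervalIntegral.integral_sub ((h.continuous_pressure_add ht).intervalIntegrable _ _)
      (cνwx.intervalIntegrable _ _), e3, sub_zero]
  rw [intervalIntegral.integral_add
    (cym'.intervalIntegrable _ _) (cG.intervalIntegrable _ _), e4] at e2
  change (∫ y in (0:ℝ)..x, m' y) - (∫ y in (0:ℝ)..1, (1 - y) * m' y) = -G x + _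
  linarith

lemma integral_pressure_le (h : IsNSFlow a γ ν η w ηt ηx wt wx wxx) (ha : 0 < a) (hγ : 1 ≤ γ)
    {t : ℝ} (ht : 0 ≤ t) :
    ∫ y in (0:ℝ)..1, (η t y * w t y ^ 2 + a * η t y ^ γ)
      ≤ (2 + γ) * ∫ y in (0:ℝ)..1, energyDensity a γ η w t y := by
  rw [← intervalIntegral.integral_const_mul]
  refine intervalIntegral.integral_mono_on zero_le_one
    ((h.continuous_pressure_add ht).intervalIntegrable _ _)
    ((continuous_const.mul (h.continuous_energyDensity_slice ht)).intervalIntegrable _ _)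
    fun y _ => ?_
  have hpos := h.pos t y ht
  have h1 := pressure_le_Ppot ha hγ hpos
  have h2 := Ppot_nonneg ha hγ hpos
  have h3 : 0 ≤ η t y * w t y ^ 2 := by positivity
  have h4 : 0 ≤ γ * (η t y * w t y ^ 2) := by positivity
  simp only [energyDensity]
  nlinarith

lemma abs_momentumPotential_le (h : IsNSFlow a γ ν η w ηt ηx wt wx wxx) (ha : 0 < a) (hγ : 1 ≤ γ)
    {t x : ℝ} (ht : 0 ≤ t) (hx : x ∈ Icc (0:ℝ) 1) :
    |momentumPotential η w t x| ≤ 1 + 2 * ∫ y in (0:ℝ)..1, energyDensity a γ η w t y := by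
  have hc : Continuous fun y => η t y * w t y :=
    h.continuous_momentum.comp (Continuous.prodMk_right t)
  have cη : Continuous (η t) := h.cη.comp (Continuous.prodMk_right t)
  have ce := h.continuous_energyDensity_slice ht
  have cη2 : Continuous fun y => (1 / 2) * η t y := continuous_const.mul cη
  have hm : ∀ y, |η t y * w t y| ≤ (1 / 2) * η t y + energyDensity a γ η w t y := by
    intro y
    have hpos := h.pos t y ht
    have h2 := Ppot_nonneg ha hγ hpos
    rw [abs_mul, abs_of_pos hpos]
    have h3 : |w t y| ≤ 1 / 2 + 1 / 2 * w t y ^ 2 := by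
      nlinarith [sq_nonneg (|w t y| - 1), sq_abs (w t y)]
    simp only [energyDensity]
    nlinarith
  have hint : ∫ y in (0:ℝ)..1, |η t y * w t y|
      ≤ 1 / 2 + ∫ y in (0:ℝ)..1, energyDensity a γ η w t y := by
    refine (intervalIntegral.integral_mono_on zero_le_one (hc.abs.intervalIntegrable _ _)
      ((cη2.add ce).intervalIntegrable _ _) fun y _ => hm y).trans ?_
    change ∫ y in (0:ℝ)..1, ((1 / 2) * η t y + energyDensity a γ η w t y) ≤ _
    rw [intervalIntegral.integral_add (cη2.intervalIntegrable _ _)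
      (ce.intervalIntegrable _ _), intervalIntegral.integral_const_mul, h.integral_density ht,
      mul_one]
  have b1 : |∫ y in (0:ℝ)..x, η t y * w t y| ≤ ∫ y in (0:ℝ)..1, |η t y * w t y| :=
    (intervalIntegral.abs_integral_le_integral_abs hx.1).trans
      (intervalIntegral.integral_mono_interval le_rfl hx.1 hx.2
        (.of_forall fun y => abs_nonneg _) (hc.abs.intervalIntegrable _ _))
  have b2 : |∫ y in (0:ℝ)..1, (1 - y) * (η t y * w t y)| ≤ ∫ y in (0:ℝ)..1, |η t y * w t y| := by
    refine (intervalIntegral.abs_integral_le_integral_abs zero_le_one).trans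
      (intervalIntegral.integral_mono_on zero_le_one
        (((continuous_const.sub continuous_id).mul hc).abs.intervalIntegrable _ _)
        (hc.abs.intervalIntegrable _ _) fun y hy => ?_)
    rw [abs_mul]
    refine mul_le_of_le_one_left (abs_nonneg _) ?_
    rw [abs_le]
    constructor <;> linarith [hy.1, hy.2]
  have := abs_sub (∫ y in (0:ℝ)..x, η t y * w t y) (∫ y in (0:ℝ)..1, (1 - y) * (η t y * w t y))
  unfold momentumPotential
  linarith

/-- The maximum principle for `F = ν log η + φ`, with `φ` the momentum potential: if `F ≤ K`
initially and `F > K` forces the pressure to exceed its spatial mean plus `∫ η w²`, then `F ≤ K`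
at all later times. -/
lemma log_add_momentumPotential_le (h : IsNSFlow a γ ν η w ηt ηx wt wx wxx) {K : ℝ}
    (h0 : ∀ x ∈ Icc (0:ℝ) 1, ν * Real.log (η 0 x) + momentumPotential η w 0 x ≤ K)
    (hK : ∀ t x, 0 ≤ t → x ∈ Icc (0:ℝ) 1 →
      K < ν * Real.log (η t x) + momentumPotential η w t x →
      ∫ y in (0:ℝ)..1, (η t y * w t y ^ 2 + a * η t y ^ γ) < a * η t x ^ γ)
    {t x : ℝ} (ht : 0 ≤ t) (hx : x ∈ Icc (0:ℝ) 1) :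
    ν * Real.log (η t x) + momentumPotential η w t x ≤ K := by
  by_contra! hlt
  have cF : ContinuousOn
      (fun p : ℝ × ℝ => ν * Real.log (uncurry η p) + uncurry (momentumPotential η w) p)
      (Icc 0 t ×ˢ Icc 0 1) :=
    (continuousOn_const.mul (h.cη.continuousOn.log fun p hp => (h.pos p.1 p.2 hp.1.1).ne')).add
      h.continuous_momentumPotential.continuousOn
  obtain ⟨⟨τ, z⟩, ⟨hτ, hz⟩, hmax⟩ :=
    (isCompact_Icc.prod isCompact_Icc).exists_isMaxOn ⟨(t, x), ⟨ht, le_rfl⟩, hx⟩ cF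
  have hmax' : ∀ s y, s ∈ Icc 0 t → y ∈ Icc (0:ℝ) 1 →
      ν * Real.log (η s y) + momentumPotential η w s y
        ≤ ν * Real.log (η τ z) + momentumPotential η w τ z :=
    fun s y hs hy => hmax (show (s, y) ∈ Icc 0 t ×ˢ Icc (0:ℝ) 1 from ⟨hs, hy⟩)
  have hgt := hlt.trans_le (hmax' t x ⟨ht, le_rfl⟩ hx)
  have hτ0 : 0 < τ := by
    rcases hτ.1.eq_or_lt with rfl | h1
    · exact absurd hgt (not_lt.mpr (h0 z hz))
    · exact h1
  have hpos := h.pos τ z hτ0.le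
  have dx : HasDerivAt (fun y => ν * Real.log (η τ y) + momentumPotential η w τ y)
      (ν * (ηx τ z / η τ z) + η τ z * w τ z) z :=
    (((h.hηx τ z).log hpos.ne').const_mul ν).add (h.hasDerivAt_momentumPotential_snd τ z)
  have dt := (((h.hηt τ z).log hpos.ne').const_mul ν).add
    (h.hasDerivAt_momentumPotential_fst hτ0.le z)
  have hx0 : ν * (ηx τ z / η τ z) + η τ z * w τ z = 0 := by
    refine IsLocalMax.hasDerivAt_eq_zero (.of_forall fun y => ?_) dx
    have hper : Function.Periodic (fun y => ν * Real.log (η τ y) + momentumPotential η w τ y) 1 :=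
      fun y => by simp only [h.perη, h.momentumPotential_periodic hτ0.le]
    obtain ⟨y', hy', hyy⟩ := hper.exists_mem_Ico₀ one_pos y
    rw [hyy]
    exact hmax' τ y' hτ (Ico_subset_Icc_self hy')
  have ht0 : ν * (ηt τ z / η τ z) + (-(η τ z * w τ z ^ 2 + a * η τ z ^ γ - ν * wx τ z)
      + ∫ y in (0:ℝ)..1, (η τ y * w τ y ^ 2 + a * η τ y ^ γ)) < 0 := by
    have h1 : ν * (ηt τ z / η τ z) = η τ z * w τ z ^ 2 - ν * wx τ z := by
      have h2 := h.mass τ z hτ0.le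
      have h3 : ηt τ z = -(ηx τ z * w τ z + η τ z * wx τ z) := by linarith
      have h4 : ν * (ηt τ z / η τ z) = -(w τ z * (ν * (ηx τ z / η τ z))) - ν * wx τ z := by
        rw [h3]
        field_simp
        ring
      rw [h4]
      linear_combination (-(w τ z)) * hx0
    linarith [hK τ z hτ0.le hz hgt]
  obtain ⟨s, hs, hslt⟩ : ∃ s ∈ Ioo 0 τ, ν * Real.log (η τ z) + momentumPotential η w τ z
      < ν * Real.log (η s z) + momentumPotential η w s z := by
    have h1 := (hasDerivAt_iff_tendsto_slope_left_right.mp dt).1.eventually (gt_mem_nhds ht0)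
    have h2 : Ioo 0 τ ∈ 𝓝[<] τ := Ioo_mem_nhdsLT hτ0
    obtain ⟨s, hs1, hs2⟩ := (h1.and h2).exists
    refine ⟨s, hs2, ?_⟩
    rw [slope_def_field] at hs1
    have h3 : s - τ < 0 := by linarith [hs2.2]
    have h4 := (div_lt_iff_of_neg h3).mp hs1
    simp only [Pi.add_apply] at h4
    linarith
  exact absurd (hmax' s z ⟨hs.1.le, hs.2.le.trans hτ.2⟩ hz) (not_le.mpr hslt)

/-- The quantitative density bound. -/
lemma density_le (h : IsNSFlow a γ ν η w ηt ηx wt wx wxx) (ha : 0 < a) (hγ : 1 ≤ γ) (hν : 0 < ν)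
    {ςbar E : ℝ} (hςbar : 0 < ςbar) (h0 : ∀ x, η 0 x ≤ ςbar)
    (hE : ∫ y in (0:ℝ)..1, energyDensity a γ η w 0 y = E) {t : ℝ} (ht : 0 ≤ t) (x : ℝ) :
    η t x ≤ Real.exp ((ν * Real.log (max ςbar (max 1 ((2 + γ) * E / a)))
      + 2 * (1 + 2 * E)) / ν) := by
  set R := max ςbar (max 1 ((2 + γ) * E / a)) with hR
  have hR0 : 0 < R := hςbar.trans_le (le_max_left _ _)
  have hφ : ∀ s y, 0 ≤ s → y ∈ Icc (0:ℝ) 1 → |momentumPotential η w s y| ≤ 1 + 2 * E := by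
    intro s y hs hy
    have h1 := h.abs_momentumPotential_le ha hγ hs hy
    have h2 := h.integral_energyDensity_le hν hs
    linarith
  have key : ∀ y ∈ Icc (0:ℝ) 1, ν * Real.log (η t y) + momentumPotential η w t y
      ≤ ν * Real.log R + (1 + 2 * E) := by
    intro y hy
    refine h.log_add_momentumPotential_le (fun y hy => ?_) (fun s y hs hy hlt => ?_) ht hy
    · have h1 := Real.log_le_log (h.pos 0 y le_rfl) ((h0 y).trans (le_max_left _ _ : ςbar ≤ R))
      have h2 := mul_le_mul_of_nonneg_left h1 hν.le
      linarith [(abs_le.mp (hφ 0 y le_rfl hy)).2]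
    · have hpos := h.pos s y hs
      have h1 : ν * Real.log R < ν * Real.log (η s y) := by
        linarith [(abs_le.mp (hφ s y hs hy)).2]
      have h2 : R < η s y := (Real.log_lt_log_iff hR0 hpos).mp (lt_of_mul_lt_mul_left h1 hν.le)
      have h3 : 1 ≤ η s y :=
        ((le_max_left _ _).trans (le_max_right _ _)).trans h2.le
      have h4 : (2 + γ) * E / a < η s y :=
        ((le_max_right _ _).trans (le_max_right _ _)).trans_lt h2
      have h5 : η s y ≤ η s y ^ γ := Real.self_le_rpow_of_one_le h3 hγ
      rw [div_lt_iff₀ ha] at h4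
      have h6 := h.integral_pressure_le ha hγ hs
      have h7 := h.integral_energyDensity_le hν hs
      rw [hE] at h7
      have h8 : (2 + γ) * ∫ y in (0:ℝ)..1, energyDensity a γ η w s y ≤ (2 + γ) * E :=
        mul_le_mul_of_nonneg_left h7 (by linarith)
      have h9 := mul_le_mul_of_nonneg_left h5 ha.le
      linarith
  have hper : Function.Periodic (η t) 1 := h.perη t
  obtain ⟨y, hy, hxy⟩ := hper.exists_mem_Ico₀ one_pos x
  have hy' := Ico_subset_Icc_self hy
  rw [hxy, ← Real.log_le_iff_le_exp (h.pos t y ht), le_div_iff₀ hν]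
  linarith [key y hy', (abs_le.mp (hφ t y ht hy')).1]

end IsNSFlow

/-- **Uniform-in-time upper bound for the density** (Proposition
`prop-upperbd-density`): there is `η̄ > 0`, depending only on
`(a, γ, ν, ς̄₀, E₀₀)`, such that every global smooth solution of the 1D
isentropic compressible Navier–Stokes system on `[0,∞) × 𝕋` with
`0 < ς̲₀ ≤ η₀ ≤ ς̄₀`, `∫_𝕋 η₀ = 1`, `∫_𝕋 η₀ w₀ = 0` and initial energy
`∫_𝕋 ((1/2) η₀ w₀² + P(η₀)) = E₀₀` satisfies `η(t,x) ≤ η̄` for all `t ≥ 0`, `x`.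
Functions on `𝕋 = ℝ/ℤ` are modelled as `1`-periodic functions of `x`. -/
theorem density_upper_bound (a γ ν ςbar E₀₀ : ℝ)
    (ha : 0 < a) (hγ : 1 ≤ γ) (hν : 0 < ν) (hςbar : 0 < ςbar) :
    ∃ ηbar : ℝ, 0 < ηbar ∧
      ∀ (η w : ℝ → ℝ → ℝ) (ςlow : ℝ),
        ContDiff ℝ (⊤ : ℕ∞) (Function.uncurry η) →
        ContDiff ℝ (⊤ : ℕ∞) (Function.uncurry w) →
        (∀ t x : ℝ, η t (x + 1) = η t x) →
        (∀ t x : ℝ, w t (x + 1) = w t x) →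
        (∀ t x : ℝ, 0 ≤ t → 0 < η t x) →
        (∀ t x : ℝ, 0 ≤ t →
          deriv (fun s => η s x) t + deriv (fun y => η t y * w t y) x = 0) →
        (∀ t x : ℝ, 0 ≤ t →
          η t x * (deriv (fun s => w s x) t + w t x * deriv (w t) x)
            - ν * deriv (deriv (w t)) x + deriv (fun y => a * η t y ^ γ) x = 0) →
        0 < ςlow →
        (∀ x : ℝ, ςlow ≤ η 0 x) →
        (∀ x : ℝ, η 0 x ≤ ςbar) →
        (∫ x in (0:ℝ)..1, η 0 x) = 1 →
        (∫ x in (0:ℝ)..1, η 0 x * w 0 x) = 0 →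
        (∫ x in (0:ℝ)..1, ((1 / 2) * η 0 x * (w 0 x) ^ 2 + Ppot a γ (η 0 x))) = E₀₀ →
        ∀ t x : ℝ, 0 ≤ t → η t x ≤ ηbar := by
  refine ⟨_, Real.exp_pos ((ν * Real.log (max ςbar (max 1 ((2 + γ) * E₀₀ / a)))
    + 2 * (1 + 2 * E₀₀)) / ν), ?_⟩
  intro η w ςlow hη hw perη perw pos mass mom _ _ hup hmass hmom hE t x ht
  have hflow : IsNSFlow a γ ν η w _ _ _ _ _ :=
    { cη := hη.continuous
      cw := hw.continuous
      cηt := (hη.uncurry_fderiv_apply (1, 0)).continuous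
      cηx := (hη.uncurry_fderiv_apply (0, 1)).continuous
      cwt := (hw.uncurry_fderiv_apply (1, 0)).continuous
      cwx := (hw.uncurry_fderiv_apply (0, 1)).continuous
      cwxx := ((hw.uncurry_fderiv_apply (0, 1)).uncurry_fderiv_apply (0, 1)).continuous
      hηt := hη.hasDerivAt_fst
      hηx := hη.hasDerivAt_snd
      hwt := hw.hasDerivAt_fst
      hwx := hw.hasDerivAt_snd
      hwxx := (hw.uncurry_fderiv_apply (0, 1)).hasDerivAt_snd
      perη := perη
      perw := perw
      pos := pos
      mass := fun s y hs => by
        have hm := mass s y hs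
        rwa [(hη.hasDerivAt_fst s y).deriv,
          ((hη.hasDerivAt_snd s y).fun_mul (hw.hasDerivAt_snd s y)).deriv] at hm
      momentum := fun s y hs => by
        have hwx : deriv (w s) = fun y => fderiv ℝ (uncurry w) (s, y) (0, 1) :=
          funext fun y => (hw.hasDerivAt_snd s y).deriv
        have hm := mom s y hs
        rw [hwx, (hw.hasDerivAt_fst s y).deriv,
          ((hw.uncurry_fderiv_apply (0, 1)).hasDerivAt_snd s y).deriv,
          (((hη.hasDerivAt_snd s y).rpow_const (p := γ)
            (Or.inl (pos s y hs).ne')).const_mul a).deriv] at hm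
        linarith
      total_mass := hmass
      total_momentum := hmom }
  exact hflow.density_le ha hγ hν hςbar hup hE ht x
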